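/- For every finite poset P, the unitary Tits form u_P is positive definite if and only if it is weakly positive definite. -/

import Mathlib

open scoped Classical

/-- The unitary Tits form `u_P` of a finite poset `P = {p_1, …, p_t}` whose strict order
is given by the relation `r` (with `r i j` meaning `p_{i+1} ≺ p_{j+1}`):
`u_P(x_0, x) = x_0² + 2(Σᵢ xᵢ² + Σ_{pᵢ≺pⱼ} xᵢxⱼ − x_0 Σᵢ xᵢ)`. -/
noncomputable def uForm (t : ℕ) (r : Fin t → Fin t → Prop) (x0 : ℤ) (x : Fin t → ℤ) : ℤ :=
  x0 ^ 2 + 2 * ((∑ i, x i ^ 2) + (∑ i, ∑ j, if r i j then x i * x j else 0)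
    - x0 * ∑ i, x i)

/-- Completing the square in `x0`: the remaining form is twice the sum of squares minus the sum
of the products `x i * x j` over the ordered pairs of incomparable (or equal) elements. -/
theorem uForm_eq_sq_add (t : ℕ) (r : Fin t → Fin t → Prop) (x0 : ℤ) (x : Fin t → ℤ) :
    uForm t r x0 x = (x0 - ∑ i, x i) ^ 2 + 2 * ∑ i, x i ^ 2 -
      ∑ i, ∑ j, (1 - (if r i j then 1 else 0) - (if r j i then 1 else 0)) * (x i * x j) := by
  have hsq : (∑ i, x i) ^ 2 = ∑ i, ∑ j, x i * x j := by
    rw [sq, Finset.sum_mul_sum]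
  have hswap : (∑ i, ∑ j, if r j i then x i * x j else 0) =
      ∑ i, ∑ j, if r i j then x i * x j else 0 := by
    rw [Finset.sum_comm]
    simp only [mul_comm]
  have hsum : (∑ i, ∑ j, (1 - (if r i j then 1 else 0) - (if r j i then 1 else 0)) *
      (x i * x j)) = (∑ i, x i) ^ 2 - 2 * ∑ i, ∑ j, if r i j then x i * x j else 0 := by
    simp only [sub_mul, ite_mul, one_mul, zero_mul, Finset.sum_sub_distrib, hswap, hsq]
    ring
  rw [hsum, uForm]
  ring

/-- Replacing `x` by its coordinatewise absolute value and `x0` by the sum of the new coordinates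
does not increase the unitary Tits form. -/
theorem uForm_abs_le (t : ℕ) (r : Fin t → Fin t → Prop) (hasymm : ∀ i j, r i j → ¬ r j i)
    (x0 : ℤ) (x : Fin t → ℤ) :
    uForm t r (∑ i, |x i|) (fun i => |x i|) ≤ uForm t r x0 x := by
  rw [uForm_eq_sq_add, uForm_eq_sq_add]
  have hprod : (∑ i, ∑ j, (1 - (if r i j then 1 else 0) - (if r j i then 1 else 0)) *
      (x i * x j)) ≤ ∑ i, ∑ j, (1 - (if r i j then 1 else 0) - (if r j i then 1 else 0)) *
      (|x i| * |x j|) := by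
    refine Finset.sum_le_sum fun i _ => Finset.sum_le_sum fun j _ => ?_
    refine mul_le_mul_of_nonneg_left ((le_abs_self _).trans_eq (abs_mul _ _)) ?_
    have := hasymm i j
    split_ifs <;> simp_all
  simp only [sq_abs, sub_self]
  linarith [sq_nonneg (x0 - ∑ i, x i)]

/-- For every finite poset `P` (elements enumerated so that `pᵢ ≺ pⱼ` implies `i < j`),
the unitary Tits form `u_P` is positive definite if and only if it is weakly positive
definite. -/
theorem uForm_positive_definite_iff_weakly_positive_definite
    (t : ℕ) (r : Fin t → Fin t → Prop)
    (htrans : ∀ i j k, r i j → r j k → r i k)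
    (henum : ∀ i j, r i j → i < j) :
    (∀ (x0 : ℤ) (x : Fin t → ℤ), ¬ (x0 = 0 ∧ ∀ i, x i = 0) → 0 < uForm t r x0 x) ↔
      (∀ (x0 : ℤ) (x : Fin t → ℤ), 0 ≤ x0 → (∀ i, 0 ≤ x i) →
        ¬ (x0 = 0 ∧ ∀ i, x i = 0) → 0 < uForm t r x0 x) := by
  refine ⟨fun h x0 x _ _ hne => h x0 x hne, fun h x0 x hne => ?_⟩
  by_cases hx : ∀ i, x i = 0
  · have hx0 : x0 ≠ 0 := fun h0 => hne ⟨h0, hx⟩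
    have : uForm t r x0 x = x0 ^ 2 := by simp [uForm, hx]
    rw [this]
    positivity
  · refine (h (∑ i, |x i|) (fun i => |x i|) (Finset.sum_nonneg fun i _ => abs_nonneg _)
      (fun i => abs_nonneg _) fun h0 => hx fun i => abs_eq_zero.mp (h0.2 i)).trans_le ?_
    exact uForm_abs_le t r (fun i j hij hji => lt_asymm (henum i j hij) (henum j i hji)) x0 x
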